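/- Let M = 2 and suppose Assumptions A and B hold. Suppose investor 1 uses the strategy λ* (constant with λ*ⁿ = E R₁ⁿ > 0) and investor 2 uses a strategy whose realization λ̃ₜ satisfies ‖λ̃ₜ − λ*‖ ≥ a almost surely for all t ≥ 1 and some a > 0, with λ̃ₜⁿ > ε̃ for all t, n and some ε̃ > 0. Then, with θ = E ln ρ₁ > 0, limsup_{l→∞} (E τₗ¹)/(E τₗ²) ≤ 1 − (|f(a)| ∧ θ)/θ. -/

import Mathlib

open MeasureTheory ProbabilityTheory Filter
open scoped ENNReal BigOperators Classical

/-- The standard simplex `Δ = {λ ∈ ℝ₊ᴺ : ∑ₙ λⁿ = 1}`. -/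
def stdSimplex' (N : ℕ) : Set (Fin N → ℝ) := {x | (∀ n, 0 ≤ x n) ∧ ∑ n, x n = 1}

/-- Euclidean norm on ℝᴺ. -/
noncomputable def l2norm {N : ℕ} (x : Fin N → ℝ) : ℝ := Real.sqrt (∑ n, (x n) ^ 2)

/-- The first time the wealth sequence `Y` reaches or exceeds the level `l`. -/
noncomputable def hitTime {Ω : Type*} (Y : ℕ → Ω → ℝ) (l : ℝ) (ω : Ω) : ℝ≥0∞ :=
  sInf ((fun t : ℕ => (t : ℝ≥0∞)) '' {t : ℕ | l ≤ Y t ω})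

/-- Expectation of a real random variable in the extended sense: `E h⁺ − E h⁻`. -/
noncomputable def eexp {Ω : Type*} [MeasurableSpace Ω] (P : Measure Ω) (h : Ω → ℝ) : EReal :=
  ((∫⁻ ω, ENNReal.ofReal (h ω) ∂P : ℝ≥0∞) : EReal) -
    ((∫⁻ ω, ENNReal.ofReal (-(h ω)) ∂P : ℝ≥0∞) : EReal)

/-- `f(a) = sup{ E ln ∑ₙ λⁿ R₁ⁿ / λ*ⁿ : λ ∈ Δ, ‖λ − λ*‖ ≥ a }`, with `f(a) = −1`
if the set is empty. -/
noncomputable def fbound {Ω : Type*} [MeasurableSpace Ω] (P : Measure Ω) {N : ℕ}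
    (R1 : Fin N → Ω → ℝ) (lamstar : Fin N → ℝ) (a : ℝ) : EReal :=
  if ∃ lam ∈ stdSimplex' N, a ≤ l2norm (fun n => lam n - lamstar n) then
    sSup {x : EReal | ∃ lam ∈ stdSimplex' N,
      a ≤ l2norm (fun n => lam n - lamstar n) ∧
      x = eexp P (fun ω => Real.log (∑ n, lam n * R1 n ω / lamstar n))}
  else (-1 : EReal)

def notYet {Ω : Type*} (Y : ℕ → Ω → ℝ) (l : ℝ) (t : ℕ) : Set Ω := {ω | ∀ s ≤ t, Y s ω < l}

lemma hitTime_eq {Ω : Type*} (Y : ℕ → Ω → ℝ) (l : ℝ) (ω : Ω) :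
    hitTime Y l ω = ∑' t, (notYet Y l t).indicator (fun _ => (1 : ℝ≥0∞)) ω := by
  unfold hitTime
  by_cases h : ∃ t, l ≤ Y t ω
  · have key : ∀ t, ω ∈ notYet Y l t ↔ t < Nat.find h := by
      intro t
      simp only [notYet, Set.mem_ofPred_eq, Nat.lt_find_iff, not_le]
    have e1 : sInf ((fun t : ℕ => (t : ℝ≥0∞)) '' {t : ℕ | l ≤ Y t ω}) = (Nat.find h : ℝ≥0∞) := by
      apply le_antisymm
      · exact sInf_le ⟨Nat.find h, Nat.find_spec h, rfl⟩
      · apply le_sInf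
        rintro _ ⟨t, ht, rfl⟩
        show ((Nat.find h : ℕ) : ℝ≥0∞) ≤ (t : ℝ≥0∞)
        exact_mod_cast Nat.find_min' h ht
    rw [e1, tsum_eq_sum (s := Finset.range (Nat.find h))]
    · rw [Finset.sum_congr rfl (g := fun _ => (1 : ℝ≥0∞))]
      · simp
      · intro t ht
        exact Set.indicator_of_mem ((key t).2 (Finset.mem_range.1 ht)) _
    · intro t ht
      exact Set.indicator_of_notMem (fun h' => ht (Finset.mem_range.2 ((key t).1 h'))) _
  · push Not at h
    have : {t : ℕ | l ≤ Y t ω} = ∅ := by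
      ext t; simp [h t]
    rw [this]
    have h2 : ∀ t, (notYet Y l t).indicator (fun _ => (1 : ℝ≥0∞)) ω = 1 := fun t =>
      Set.indicator_of_mem (show ω ∈ notYet Y l t from fun s _ => h s) _
    simp [h2]

lemma lintegral_hitTime {Ω : Type*} [MeasurableSpace Ω] (P : Measure Ω) (Y : ℕ → Ω → ℝ) (l : ℝ)
    (hA : ∀ t, MeasurableSet (notYet Y l t)) :
    ∫⁻ ω, hitTime Y l ω ∂P = ∑' t, P (notYet Y l t) := by
  simp_rw [hitTime_eq]
  rw [lintegral_tsum]
  · congr 1; ext t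
    simp [lintegral_indicator (hA t)]
  · intro t
    exact (measurable_const.indicator (hA t)).aemeasurable

lemma upper_aux {Ω : Type*} [MeasurableSpace Ω] (P : Measure Ω) [IsProbabilityMeasure P]
    (L x q : ℕ → Ω → ℝ) (ℓ L0 C θ σ δ : ℝ) (hδ : 0 < δ) (hC : 0 ≤ C) (hl : L0 ≤ ℓ)
    (hL0 : ∀ ω, L 0 ω = L0) (hrec : ∀ t ω, L (t+1) ω = L t ω + x t ω + q t ω)
    (hA : ∀ t, MeasurableSet (notYet L ℓ t))
    (hqC : ∀ t ω, q t ω ≤ C) (hx : ∀ t, Integrable (x t) P) (hx2 : ∀ t, Integrable (fun ω => x t ω ^ 2) P)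
    (hq : ∀ t, Integrable (q t) P)
    (h1 : ∀ t, ∫ ω in notYet L ℓ t, x t ω ∂P = θ * P.real (notYet L ℓ t))
    (h2 : ∀ t, ∫ ω in notYet L ℓ t, x t ω ^ 2 ∂P = σ * P.real (notYet L ℓ t))
    (h3 : ∀ t, 0 ≤ ∫ ω in notYet L ℓ t, q t ω ∂P) (T : ℕ) :
    (θ - δ * σ) * ∑ t ∈ Finset.range T, P.real (notYet L ℓ t) ≤ ℓ - L0 + C + 1 / (4 * δ) := by
  set A := notYet L ℓ with hAdef
  have mono : ∀ t ω, ω ∈ A (t+1) → ω ∈ A t := fun t ω h s hs => h s (by omega)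
  have path : ∀ ω T, (∑ t ∈ Finset.range T, (A t).indicator (fun ω => x t ω + q t ω - δ * x t ω ^ 2) ω
      ≤ ℓ - L0 + C + 1 / (4 * δ)) ∧ (ω ∈ A T → ∑ t ∈ Finset.range T, (A t).indicator (fun ω => x t ω + q t ω - δ * x t ω ^ 2) ω
      ≤ L T ω - L0) := by
    intro ω T
    have hd : 0 < 1 / (4 * δ) := by positivity
    induction T with
    | zero => simp [hL0]; exact by have : 0 < δ⁻¹ * 4⁻¹ := by positivity
                                   linarith
    | succ T ih =>
      rw [Finset.sum_range_succ]
      by_cases h : ω ∈ A T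
      · rw [Set.indicator_of_mem h]
        have h4 := ih.2 h
        have h5 : L T ω < ℓ := h T le_rfl
        have h6 := hqC T ω
        have h7 : x T ω ≤ δ * x T ω ^ 2 + 1 / (4 * δ) := by
          have : δ * x T ω ^ 2 + 1 / (4 * δ) - x T ω = δ * (x T ω - 1 / (2 * δ)) ^ 2 := by
            field_simp; ring
          have h8 : 0 ≤ δ * (x T ω - 1 / (2 * δ)) ^ 2 := by positivity
          linarith
        refine ⟨by linarith, fun _ => ?_⟩
        rw [hrec]
        have : 0 ≤ δ * x T ω ^ 2 := by positivity
        linarith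
      · rw [Set.indicator_of_notMem h, add_zero]
        exact ⟨ih.1, fun h' => absurd (mono _ _ h') h⟩
  have int : ∀ t, Integrable (fun ω => x t ω + q t ω - δ * x t ω ^ 2) P := fun t =>
    ((hx t).add (hq t)).sub ((hx2 t).const_mul δ)
  have e : ∫ ω, ∑ t ∈ Finset.range T, (A t).indicator (fun ω => x t ω + q t ω - δ * x t ω ^ 2) ω ∂P
      ≤ ∫ ω, (ℓ - L0 + C + 1 / (4 * δ)) ∂P := by
    apply integral_mono
    · exact integrable_finsetSum _ fun t _ => (int t).indicator (hA t)
    · exact integrable_const _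
    · exact fun ω => (path ω T).1
  rw [integral_finsetSum _ fun t _ => (int t).indicator (hA t)] at e
  simp only [integral_const, probReal_univ, one_smul] at e
  refine le_trans ?_ e
  rw [Finset.mul_sum]
  apply Finset.sum_le_sum
  intro t _
  rw [integral_indicator (hA t), integral_sub (f := fun ω => x t ω + q t ω) ((hx t).add (hq t)).integrableOn ((hx2 t).const_mul δ).integrableOn, integral_add (hx t).integrableOn (hq t).integrableOn, integral_const_mul, h1, h2]
  linarith [h3 t]

lemma lower_aux {Ω : Type*} [MeasurableSpace Ω] (P : Measure Ω) [IsProbabilityMeasure P]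
    (L x q u : ℕ → Ω → ℝ) (ℓ L0 C D θ κ f K δ : ℝ) (hδ : 0 < δ) (hC : 0 ≤ C) 
    (hL0 : ∀ ω, L 0 ω = L0) (hrec : ∀ t ω, L (t+1) ω = L t ω + x t ω + q t ω)
    (hA : ∀ t, MeasurableSet (notYet L ℓ t))
    (hqC : ∀ t ω, |q t ω| ≤ D) (hx : ∀ t, Integrable (x t) P)
    (hq : ∀ t, Integrable (q t) P) (hu : ∀ t, Integrable (u t) P)
    (hu2 : ∀ t, Integrable (fun ω => u t ω ^ 2) P)
    (h1 : ∀ t, ∫ ω in notYet L ℓ t, x t ω ∂P = θ * P.real (notYet L ℓ t))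
    (h2 : ∀ t, ∫ ω in notYet L ℓ t, |x t ω| ∂P = κ * P.real (notYet L ℓ t))
    (h3 : ∀ t, ∫ ω in notYet L ℓ t, q t ω ∂P ≤ f * P.real (notYet L ℓ t) + C * ∫ ω in notYet L ℓ t, u t ω ∂P)
    (hK : ∀ T, ∑ t ∈ Finset.range T, ∫ ω, u t ω ^ 2 ∂P ≤ K)
    (hs : Summable fun t => P.real (notYet L ℓ t)) :
    ℓ - L0 ≤ (θ + f + C * δ) * ∑' t, P.real (notYet L ℓ t) + C * (K / δ) := by
  set A := notYet L ℓ with hAdef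
  set F : ℕ → Ω → ℝ := fun t => (A t).indicator (fun ω => x t ω + q t ω) with hF
  have int : ∀ t, Integrable (fun ω => x t ω + q t ω) P := fun t => (hx t).add (hq t)
  have intF : ∀ t, Integrable (F t) P := fun t => (int t).indicator (hA t)
  have hnorm : ∀ t, ∫ ω, ‖F t ω‖ ∂P ≤ (κ + D) * P.real (A t) := by
    intro t
    have : (fun ω => ‖F t ω‖) = (A t).indicator (fun ω => |x t ω + q t ω|) := by
      ext ω; simp only [hF]; rw [norm_indicator_eq_indicator_norm]; rfl
    rw [this, integral_indicator (hA t)]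
    calc ∫ ω in A t, |x t ω + q t ω| ∂P ≤ ∫ ω in A t, (|x t ω| + D) ∂P := by
          apply integral_mono (int t).abs.integrableOn ((hx t).abs.integrableOn.add (integrable_const _))
          intro ω
          exact (abs_add_le _ _).trans (by simpa using hqC t ω)
      _ = (κ + D) * P.real (A t) := by
          rw [integral_add (hx t).abs.integrableOn (integrable_const _), h2]
          simp [Measure.real]; ring
  have sumF : Summable fun t => ∫ ω, ‖F t ω‖ ∂P :=
    Summable.of_nonneg_of_le (fun t => integral_nonneg fun _ => norm_nonneg _) hnorm (hs.mul_left _)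
  have key := hasSum_integral_of_summable_integral_norm intF sumF
  -- finite a.s.
  have fin : ∀ᵐ ω ∂P, ∃ t, ω ∉ A t := by
    have h0 : P (⋂ t, A t) = 0 := by
      have hle : ∀ t, P.real (⋂ t, A t) ≤ P.real (A t) := fun t =>
        measureReal_mono (Set.iInter_subset _ t)
      have : P.real (⋂ t, A t) ≤ 0 := ge_of_tendsto' hs.tendsto_atTop_zero hle
      have h' := le_antisymm this measureReal_nonneg
      simpa [Measure.real, ENNReal.toReal_eq_zero_iff] using h'
    have := compl_mem_ae_iff.2 h0
    filter_upwards [this] with ω hω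
    simpa using hω
  have intSum : Integrable (fun ω => ∑' t, F t ω) P := by
    have hm : AEStronglyMeasurable (fun ω => ∑' t, F t ω) P := by
      refine (AEMeasurable.aestronglyMeasurable ?_)
      refine aemeasurable_of_tendsto_metrizable_ae atTop (f := fun T ω => ∑ t ∈ Finset.range T, F t ω) (fun T => (integrable_finsetSum _ fun t _ => intF t).1.aemeasurable) ?_
      filter_upwards [fin] with ω hω
      obtain ⟨k, hk⟩ := hω
      apply HasSum.tendsto_sum_nat
      apply Summable.hasSum
      apply summable_of_ne_finset_zero (s := Finset.range k)
      intro t ht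
      refine Set.indicator_of_notMem (fun (h' : ∀ s ≤ t, L s ω < ℓ) => hk fun s hs => h' s ?_) _
      have := mt Finset.mem_range.2 ht
      omega
    refine ⟨hm, ?_⟩
    have hle : ∫⁻ ω, ‖∑' t, F t ω‖ₑ ∂P ≤ ∑' t, ∫⁻ ω, ‖F t ω‖ₑ ∂P := by
      rw [← lintegral_tsum fun t => (intF t).1.enorm]
      exact lintegral_mono fun ω => enorm_tsum_le_tsum_enorm
    refine lt_of_le_of_lt hle ?_
    have : ∀ t, ∫⁻ ω, ‖F t ω‖ₑ ∂P = ENNReal.ofReal (∫ ω, ‖F t ω‖ ∂P) := fun t =>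
      (ofReal_integral_norm_eq_lintegral_enorm (intF t)).symm
    simp_rw [this]
    rw [← ENNReal.ofReal_tsum_of_nonneg (fun t => integral_nonneg fun _ => norm_nonneg _) sumF]
    exact ENNReal.ofReal_lt_top
  have low : ℓ - L0 ≤ ∫ ω, ∑' t, F t ω ∂P := by
    have : ∫ ω, (ℓ - L0) ∂P ≤ ∫ ω, ∑' t, F t ω ∂P := by
      apply integral_mono_ae (integrable_const _) intSum
      filter_upwards [fin] with ω hω
      have hlt : ∀ t, t < Nat.find hω → ω ∈ A t := fun t ht => not_not.1 (Nat.find_min hω ht)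
      have hge : ∀ t, ω ∈ A t → t < Nat.find hω := by
        intro t ht
        by_contra hh
        exact Nat.find_spec hω (fun s hs => ht s (by omega))
      have tel : ∀ T, T ≤ Nat.find hω → ∑ t ∈ Finset.range T, F t ω = L T ω - L0 := by
        intro T hT
        induction T with
        | zero => simp [hL0]
        | succ T ih =>
          rw [Finset.sum_range_succ, ih (by omega)]
          simp only [hF]
          rw [Set.indicator_of_mem (hlt T (by omega)), hrec]; ring
      show ℓ - L0 ≤ ∑' t, F t ω
      rw [tsum_eq_sum (s := Finset.range (Nat.find hω)), tel _ le_rfl]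
      · have h4 := Nat.find_spec hω
        by_contra hh
        apply h4
        intro s hs
        rcases hs.lt_or_eq with h5 | h5
        · exact hlt s h5 s le_rfl
        · rw [h5]; linarith
      · intro t ht
        exact Set.indicator_of_notMem (fun h' => ht (Finset.mem_range.2 (hge t h'))) _
    simpa using this
  refine low.trans ?_
  refine le_of_tendsto_of_tendsto' key.tendsto_sum_nat
    ((hs.hasSum.tendsto_sum_nat.const_mul (θ + f + C * δ)).add_const (C * (K / δ))) ?_
  intro T
  have hT := hK T
  have each : ∀ t, ∫ ω, F t ω ∂P ≤ (θ + f + C * δ) * P.real (A t) + C * ((∫ ω, u t ω ^ 2 ∂P) / δ) := by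
    intro t
    have h4 : ∫ ω in A t, u t ω ∂P ≤ δ * P.real (A t) + (∫ ω, u t ω ^ 2 ∂P) / δ := by
      calc ∫ ω in A t, u t ω ∂P ≤ ∫ ω in A t, (δ + u t ω ^ 2 / δ) ∂P := by
            apply integral_mono (hu t).integrableOn
              ((integrable_const _).add ((hu2 t).integrableOn.div_const _))
            intro ω
            have : δ + u t ω ^ 2 / δ - u t ω = ((u t ω - δ / 2) ^ 2 + 3 / 4 * δ ^ 2) / δ := by
              field_simp; ring
            have h0 : 0 ≤ ((u t ω - δ / 2) ^ 2 + 3 / 4 * δ ^ 2) / δ := by positivity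
            show u t ω ≤ δ + u t ω ^ 2 / δ
            linarith
        _ = δ * P.real (A t) + (∫ ω in A t, u t ω ^ 2 ∂P) / δ := by
            rw [integral_add (integrable_const _) ((hu2 t).integrableOn.div_const _), integral_div]
            simp [Measure.real]; ring
        _ ≤ _ := by
            have h9 := setIntegral_le_integral (s := A t) (hu2 t) (Eventually.of_forall fun _ => sq_nonneg _)
            have h8 := div_le_div_of_nonneg_right h9 hδ.le
            linarith
    have h5 : C * ∫ ω in A t, u t ω ∂P ≤ C * (δ * P.real (A t) + (∫ ω, u t ω ^ 2 ∂P) / δ) :=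
      mul_le_mul_of_nonneg_left h4 hC
    simp only [hF]
    rw [integral_indicator (hA t), integral_add (hx t).integrableOn (hq t).integrableOn, h1]
    have := h3 t
    nlinarith
  refine (Finset.sum_le_sum fun t _ => each t).trans ?_
  rw [Finset.sum_add_distrib, ← Finset.mul_sum, ← Finset.mul_sum, ← Finset.sum_div]
  gcongr

lemma simplex_le_one {N : ℕ} {x : Fin N → ℝ} (h : x ∈ stdSimplex' N) (n : Fin N) : x n ≤ 1 := by
  rw [← h.2]
  exact Finset.single_le_sum (fun i _ => h.1 i) (Finset.mem_univ n)

lemma avg_bounds {N : ℕ} {r c : Fin N → ℝ} (hr : r ∈ stdSimplex' N) {lo hi : ℝ}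
    (h1 : ∀ n, lo ≤ c n) (h2 : ∀ n, c n ≤ hi) :
    lo ≤ ∑ n, c n * r n ∧ ∑ n, c n * r n ≤ hi := by
  have e1 : lo = ∑ n, lo * r n := by rw [← Finset.mul_sum, hr.2, mul_one]
  have e2 : hi = ∑ n, hi * r n := by rw [← Finset.mul_sum, hr.2, mul_one]
  constructor
  · rw [e1]
    exact Finset.sum_le_sum fun n _ => mul_le_mul_of_nonneg_right (h1 n) (hr.1 n)
  · rw [e2]
    exact Finset.sum_le_sum fun n _ => mul_le_mul_of_nonneg_right (h2 n) (hr.1 n)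

lemma log_avg_bounds {N : ℕ} {r c : Fin N → ℝ} (hr : r ∈ stdSimplex' N) {lo hi : ℝ} (hlo : 0 < lo)
    (h1 : ∀ n, lo ≤ c n) (h2 : ∀ n, c n ≤ hi) :
    Real.log lo ≤ Real.log (∑ n, c n * r n) ∧ Real.log (∑ n, c n * r n) ≤ Real.log hi := by
  obtain ⟨a, b⟩ := avg_bounds hr h1 h2
  exact ⟨Real.log_le_log hlo a, Real.log_le_log (hlo.trans_le a) b⟩

lemma log_avg_jensen {N : ℕ} {r c : Fin N → ℝ} (hr : r ∈ stdSimplex' N) (hc : ∀ n, 0 < c n) :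
    ∑ n, Real.log (c n) * r n ≤ Real.log (∑ n, c n * r n) := by
  have := strictConcaveOn_log_Ioi.concaveOn.le_map_sum (t := Finset.univ) (w := r) (p := c)
    (fun i _ => hr.1 i) hr.2 (fun i _ => hc i)
  simpa [mul_comm] using this

lemma kl_one {p w : ℝ} (hp : 0 < p) (hw : 0 < w) (hp1 : p ≤ 1) (hw1 : w ≤ 1) :
    (p - w) ^ 2 / 4 ≤ p * Real.log (p / w) - p + w := by
  set s := Real.sqrt p
  set r := Real.sqrt w
  have hs : 0 < s := Real.sqrt_pos.2 hp
  have hr : 0 < r := Real.sqrt_pos.2 hw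
  have hs2 : p = s ^ 2 := (Real.sq_sqrt hp.le).symm
  have hr2 : w = r ^ 2 := (Real.sq_sqrt hw.le).symm
  have hs1 : s ≤ 1 := Real.sqrt_le_one.2 hp1
  have hr1 : r ≤ 1 := Real.sqrt_le_one.2 hw1
  have hlog : Real.log (p / w) = - (2 * Real.log (r / s)) := by
    rw [hs2, hr2, Real.log_div (by positivity) (by positivity), Real.log_div (by positivity) (by positivity), Real.log_pow, Real.log_pow]
    push_cast; ring
  have h1 := Real.log_le_sub_one_of_pos (div_pos hr hs)
  have h2 : p * Real.log (p / w) ≥ 2 * p - 2 * s * r := by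
    rw [hlog]
    have : s ^ 2 * Real.log (r / s) ≤ s ^ 2 * (r / s - 1) := by gcongr
    have e : s ^ 2 * (r / s - 1) = s * r - s ^ 2 := by field_simp
    rw [hs2]; linarith
  have h3 : (p - w) ^ 2 / 4 ≤ (s - r) ^ 2 := by
    have : (p - w) ^ 2 = (s - r) ^ 2 * (s + r) ^ 2 := by rw [hs2, hr2]; ring
    rw [this]
    have : (s + r) ^ 2 ≤ 4 := by nlinarith
    nlinarith [sq_nonneg (s - r)]
  nlinarith

lemma kl_sum {N : ℕ} {p w : Fin N → ℝ} (hp : p ∈ stdSimplex' N) (hw : w ∈ stdSimplex' N)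
    (hp0 : ∀ n, 0 < p n) (hw0 : ∀ n, 0 < w n) :
    (∑ n, (p n - w n) ^ 2) / 4 ≤ ∑ n, Real.log (p n / w n) * p n := by
  have : ∑ n, (p n - w n) ^ 2 / 4 ≤ ∑ n, (p n * Real.log (p n / w n) - p n + w n) :=
    Finset.sum_le_sum fun n _ => kl_one (hp0 n) (hw0 n) (simplex_le_one hp n) (simplex_le_one hw n)
  rw [Finset.sum_add_distrib, Finset.sum_sub_distrib, hp.2, hw.2, ← Finset.sum_div] at this
  simp_rw [mul_comm (Real.log _)]
  linarith

lemma log_compare {N : ℕ} {r p v w : Fin N → ℝ} {u m : ℝ} (hr : r ∈ stdSimplex' N)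
    (hv : ∀ n, 0 < v n) (hp0 : ∀ n, 0 < p n) (hp1 : ∀ n, p n ≤ 1) (hm : 0 < m) (hw : ∀ n, m ≤ w n)
    (hu : 0 ≤ u) (hwdef : ∀ n, w n = p n + u * (v n - p n)) :
    Real.log (∑ n, v n / w n * r n) ≤ Real.log (∑ n, v n / p n * r n) + u / m := by
  have hw0 : ∀ n, 0 < w n := fun n => hm.trans_le (hw n)
  have hne : 0 < ∑ n, v n / w n * r n ∧ 0 < ∑ n, v n / p n * r n := by
    have : ∃ n, 0 < r n := by
      by_contra hcon
      push Not at hcon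
      have := Finset.sum_nonpos (s := Finset.univ) fun n _ => hcon n
      linarith [hr.2]
    obtain ⟨n, hn⟩ := this
    exact ⟨Finset.sum_pos' (fun i _ => mul_nonneg (div_pos (hv i) (hw0 i)).le (hr.1 i))
      ⟨n, Finset.mem_univ n, mul_pos (div_pos (hv n) (hw0 n)) hn⟩,
      Finset.sum_pos' (fun i _ => mul_nonneg (div_pos (hv i) (hp0 i)).le (hr.1 i))
      ⟨n, Finset.mem_univ n, mul_pos (div_pos (hv n) (hp0 n)) hn⟩⟩
  have hle : ∑ n, v n / w n * r n ≤ (1 + u / m) * ∑ n, v n / p n * r n := by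
    rw [Finset.mul_sum]
    apply Finset.sum_le_sum
    intro n _
    rw [← mul_assoc]
    apply mul_le_mul_of_nonneg_right _ (hr.1 n)
    rw [← mul_div_assoc, div_le_div_iff₀ (hw0 n) (hp0 n)]
    have h1 : p n ≤ (1 + u / m) * w n := by
      have h2 : u ≤ u / m * w n := by
        rw [div_mul_eq_mul_div, le_div_iff₀ hm]
        exact mul_le_mul_of_nonneg_left (hw n) hu
      have h3 : u * (p n - v n) ≤ u * 1 := mul_le_mul_of_nonneg_left (by linarith [hv n, hp1 n]) hu
      have := hwdef n
      nlinarith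
    nlinarith [hv n]
  have hpos : 0 < 1 + u / m := by positivity
  calc _ ≤ Real.log ((1 + u / m) * ∑ n, v n / p n * r n) := Real.log_le_log hne.1 hle
    _ = Real.log (1 + u / m) + Real.log (∑ n, v n / p n * r n) := Real.log_mul hpos.ne' hne.2.ne'
    _ ≤ _ := by linarith [Real.log_le_sub_one_of_pos hpos]

lemma indep_mul {Ω β : Type*} {m1 m0 : MeasurableSpace Ω} [mβ : MeasurableSpace β] (P : Measure Ω)
    [IsProbabilityMeasure P] (hm : m1 ≤ m0) (G : Ω → β) (hG : Measurable G)
    (hind : Indep (MeasurableSpace.comap G mβ) m1 P) (H : β → ℝ) (hH : Measurable H)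
    (Z : Ω → ℝ) (hZ : Measurable[m1] Z) :
    ∫ ω, Z ω * H (G ω) ∂P = (∫ ω, Z ω ∂P) * ∫ ω, H (G ω) ∂P := by
  have : IndepFun Z (fun ω => H (G ω)) P := by
    rw [IndepFun_iff_Indep]
    refine (indep_of_indep_of_le_right (indep_of_indep_of_le_left hind ?_) hZ.comap_le).symm
    rintro _ ⟨s, hs, rfl⟩
    exact ⟨H ⁻¹' s, hH hs, rfl⟩
  exact this.integral_fun_mul_eq_mul_integral (hZ.mono hm le_rfl).aestronglyMeasurable
    (hH.comp hG).aestronglyMeasurable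

lemma indep_set {Ω β : Type*} {m1 m0 : MeasurableSpace Ω} [mβ : MeasurableSpace β] (P : Measure Ω)
    [IsProbabilityMeasure P] (hm : m1 ≤ m0) (G : Ω → β) (hG : Measurable G)
    (hind : Indep (MeasurableSpace.comap G mβ) m1 P) (H : β → ℝ) (hH : Measurable H)
    (A : Set Ω) (hA : MeasurableSet[m1] A) :
    ∫ ω in A, H (G ω) ∂P = (∫ ω, H (G ω) ∂P) * P.real A := by
  have h := indep_mul P hm G hG hind H hH (A.indicator 1) (by
    refine Measurable.indicator ?_ hA
    exact @measurable_const _ _ _ m1 (1 : ℝ))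
  rw [integral_indicator_one (hm _ hA)] at h
  rw [← integral_indicator (hm _ hA), mul_comm, ← h]
  congr 1; ext ω
  by_cases hω : ω ∈ A <;> simp [hω]

lemma int_of_bdd {Ω : Type*} {m0 : MeasurableSpace Ω} (P : Measure Ω)
    [IsProbabilityMeasure P] {f : Ω → ℝ} (hf : Measurable f) {lo hi : ℝ}
    (h : ∀ ω, lo ≤ f ω ∧ f ω ≤ hi) : Integrable f P :=
  Integrable.of_mem_Icc lo hi hf.aemeasurable (Eventually.of_forall h)

lemma kl_int {Ω : Type*} {m1 m0 : MeasurableSpace Ω} (P : Measure Ω)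
    [IsProbabilityMeasure P] (hm : m1 ≤ m0) {N : ℕ} (p : Fin N → ℝ) (R w : Fin N → Ω → ℝ)
    (hR : ∀ n, Measurable (R n)) (hind : Indep (MeasurableSpace.comap (fun ω n => R n ω) inferInstance) m1 P)
    (hRs : ∀ ω, (fun n => R n ω) ∈ stdSimplex' N) (hRp : ∀ n, ∫ ω, R n ω ∂P = p n)
    (hp : p ∈ stdSimplex' N) {m : ℝ} (hm0 : 0 < m) (hpm : ∀ n, m ≤ p n)
    (hw : ∀ n, Measurable[m1] (w n)) (hws : ∀ ω, (fun n => w n ω) ∈ stdSimplex' N)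
    (hwm : ∀ n ω, m ≤ w n ω) (A : Set Ω) (hA : MeasurableSet[m1] A) :
    ∫ ω in A, (∑ n, (p n - w n ω) ^ 2) / 4 ∂P ≤ ∫ ω in A, Real.log (∑ n, p n / w n ω * R n ω) ∂P := by
  have hw0 : ∀ n ω, 0 < w n ω := fun n ω => hm0.trans_le (hwm n ω)
  have hp0 : ∀ n, 0 < p n := fun n => hm0.trans_le (hpm n)
  have hc : ∀ n ω, m ≤ p n / w n ω ∧ p n / w n ω ≤ 1 / m := by
    intro n ω
    constructor
    · rw [le_div_iff₀ (hw0 n ω)]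
      have := simplex_le_one (hws ω) n
      have := hpm n
      nlinarith
    · exact div_le_div₀ zero_le_one (simplex_le_one hp n) hm0 (hwm n ω)
  have hw' : ∀ n, Measurable (w n) := fun n => (hw n).mono hm le_rfl
  have ilog : ∀ n, Integrable (fun ω => Real.log (p n / w n ω)) P := fun n =>
    int_of_bdd P (by have := hw' n; fun_prop) (lo := Real.log m) (hi := Real.log (1 / m)) fun ω =>
      ⟨Real.log_le_log hm0 (hc n ω).1, Real.log_le_log (hm0.trans_le (hc n ω).1) (hc n ω).2⟩
  have ilogR : ∀ n, Integrable (fun ω => Real.log (p n / w n ω) * R n ω) P := by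
    intro n
    refine (ilog n).mul_bdd (c := 1) (hR n).aestronglyMeasurable (Eventually.of_forall fun ω => ?_)
    rw [Real.norm_of_nonneg ((hRs ω).1 n)]
    exact simplex_le_one (hRs ω) n
  have isq : Integrable (fun ω => (∑ n, (p n - w n ω) ^ 2) / 4) P := by
    apply Integrable.div_const
    apply integrable_finsetSum
    intro n _
    refine int_of_bdd P (by have := hw' n; fun_prop) (lo := 0) (hi := 1) fun ω => ⟨sq_nonneg _, ?_⟩
    have h1 := simplex_le_one (hws ω) n
    have h2 := simplex_le_one hp n
    have h3 := hw0 n ω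
    have h4 := hp0 n
    rw [sq_le_one_iff_abs_le_one, abs_le]
    constructor <;> linarith
  have step1 : ∫ ω in A, ∑ n, Real.log (p n / w n ω) * R n ω ∂P ≤
      ∫ ω in A, Real.log (∑ n, p n / w n ω * R n ω) ∂P := by
    apply integral_mono (integrable_finsetSum _ fun n _ => (ilogR n).integrableOn)
    · refine Integrable.integrableOn (int_of_bdd P (by fun_prop) (lo := Real.log m) (hi := Real.log (1 / m)) fun ω => ?_)
      exact log_avg_bounds (hRs ω) hm0 (fun n => (hc n ω).1) (fun n => (hc n ω).2)
    · intro ω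
      exact log_avg_jensen (hRs ω) (fun n => hm0.trans_le (hc n ω).1)
  have step2 : ∫ ω in A, ∑ n, Real.log (p n / w n ω) * R n ω ∂P =
      ∫ ω in A, ∑ n, Real.log (p n / w n ω) * p n ∂P := by
    rw [integral_finsetSum _ fun n _ => (ilogR n).integrableOn,
      integral_finsetSum _ fun n _ => ((ilog n).mul_const _).integrableOn]
    apply Finset.sum_congr rfl
    intro n _
    rw [integral_mul_const, ← integral_indicator (hm _ hA), ← integral_indicator (hm _ hA)]
    have hZ : Measurable[m1] (A.indicator fun ω => Real.log (p n / w n ω)) := by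
      refine Measurable.indicator ?_ hA
      exact Real.measurable_log.comp ((hw n).const_div _)
    have := indep_mul P hm (fun ω n => R n ω) (measurable_pi_lambda _ hR) hind (fun r => r n) (measurable_pi_apply n) _ hZ
    simp only [hRp] at this
    rw [← this]
    congr 1; ext ω
    by_cases hω : ω ∈ A <;> simp [hω]
  rw [step2] at step1
  refine le_trans ?_ step1
  apply integral_mono isq.integrableOn (integrable_finsetSum _ fun n _ => ((ilog n).mul_const _).integrableOn)
  intro ω
  exact kl_sum hp (hws ω) hp0 (fun n => hw0 n ω)

lemma f_int {Ω : Type*} {m1 m0 : MeasurableSpace Ω} (P : Measure Ω)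
    [IsProbabilityMeasure P] (hm : m1 ≤ m0) {N : ℕ} (p : Fin N → ℝ) (R v : Fin N → Ω → ℝ)
    (hR : ∀ n, Measurable (R n)) (hind : Indep (MeasurableSpace.comap (fun ω n => R n ω) inferInstance) m1 P)
    (hRs : ∀ ω, (fun n => R n ω) ∈ stdSimplex' N) 
    (hp : p ∈ stdSimplex' N) {m a f : ℝ} (hm0 : 0 < m) (hpm : ∀ n, m ≤ p n)
    (hv : ∀ n, Measurable[m1] (v n)) (hvs : ∀ ω, (fun n => v n ω) ∈ stdSimplex' N)
    (hvm : ∀ n ω, m ≤ v n ω) (hfar : ∀ᵐ ω ∂P, a ≤ l2norm (fun n => v n ω - p n))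
    (hf : ∀ lam ∈ stdSimplex' N, (∀ n, m ≤ lam n) → a ≤ l2norm (fun n => lam n - p n) →
      ∫ ω, Real.log (∑ n, lam n / p n * R n ω) ∂P ≤ f)
    (A : Set Ω) (hA : MeasurableSet[m1] A) :
    ∫ ω in A, Real.log (∑ n, v n ω / p n * R n ω) ∂P ≤ f * P.real A := by
  have hp0 : ∀ n, 0 < p n := fun n => hm0.trans_le (hpm n)
  have hv' : ∀ n, Measurable (v n) := fun n => (hv n).mono hm le_rfl
  have hc : ∀ n ω, m ≤ v n ω / p n ∧ v n ω / p n ≤ 1 / m := by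
    intro n ω
    constructor
    · rw [le_div_iff₀ (hp0 n)]
      have := simplex_le_one hp n
      have := hvm n ω
      nlinarith
    · exact div_le_div₀ zero_le_one (simplex_le_one (hvs ω) n) hm0 (hpm n)
  set V : Ω → (Fin N → ℝ) × ℝ := fun ω => (fun n => v n ω, A.indicator (fun _ => 1) ω) with hV
  set G : Ω → (Fin N → ℝ) := fun ω n => R n ω with hG
  have hVm1 : Measurable[m1] V := by
    refine Measurable.prodMk ?_ ?_
    · exact @measurable_pi_lambda _ _ _ m1 _ _ hv
    · refine Measurable.indicator ?_ hA
      exact @measurable_const _ _ _ m1 (1 : ℝ)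
  have hVm : Measurable V := hVm1.mono hm le_rfl
  have hGm : Measurable G := measurable_pi_lambda _ hR
  have hIF : IndepFun V G P := by
    rw [IndepFun_iff_Indep]
    exact (indep_of_indep_of_le_right hind hVm1.comap_le).symm
  have hprod := (indepFun_iff_map_prod_eq_prod_map_map hVm.aemeasurable hGm.aemeasurable).1 hIF
  set Φ : ((Fin N → ℝ) × ℝ) × (Fin N → ℝ) → ℝ := fun z => z.1.2 * Real.log (∑ n, z.1.1 n / p n * z.2 n) with hΦ
  have hΦm : Measurable Φ := by
    simp only [hΦ]; fun_prop
  have iΦ : Integrable (fun ω => Φ (V ω, G ω)) P := by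
    have h1 : Integrable (A.indicator fun ω => Real.log (∑ n, v n ω / p n * R n ω)) P := by
      refine Integrable.indicator (int_of_bdd P (by fun_prop) (lo := Real.log m) (hi := Real.log (1 / m)) fun ω => ?_) (hm _ hA)
      exact log_avg_bounds (hRs ω) hm0 (fun n => (hc n ω).1) (fun n => (hc n ω).2)
    convert h1 using 2 with ω
    by_cases hω : ω ∈ A <;> simp [hω, hΦ, hV, hG]
  have e0 : ∫ ω in A, Real.log (∑ n, v n ω / p n * R n ω) ∂P = ∫ ω, Φ (V ω, G ω) ∂P := by
    rw [← integral_indicator (hm _ hA)]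
    congr 1; ext ω
    by_cases hω : ω ∈ A <;> simp [hω, hΦ, hV, hG]
  have hVG : Measurable fun ω => (V ω, G ω) := hVm.prodMk hGm
  have iΦ' : Integrable Φ ((P.map V).prod (P.map G)) := by
    rw [← hprod]
    exact (integrable_map_measure hΦm.aestronglyMeasurable hVG.aemeasurable).2 iΦ
  have : IsProbabilityMeasure (P.map V) := Measure.isProbabilityMeasure_map hVm.aemeasurable
  have : IsProbabilityMeasure (P.map G) := Measure.isProbabilityMeasure_map hGm.aemeasurable
  rw [e0, ← integral_map (φ := fun ω => (V ω, G ω)) hVG.aemeasurable hΦm.aestronglyMeasurable, hprod, integral_prod _ iΦ']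
  rw [integral_map hVm.aemeasurable]
  swap
  · exact iΦ'.1.integral_prod_right'
  have e1 : f * P.real A = ∫ ω, A.indicator (fun _ => f) ω ∂P := by
    rw [integral_indicator (hm _ hA)]; simp [Measure.real, mul_comm]
  rw [e1]
  apply integral_mono_ae
  · have := iΦ'.integral_prod_left
    exact (integrable_map_measure this.1 hVm.aemeasurable).1 this
  · exact (integrable_const _).indicator (hm _ hA)
  · filter_upwards [hfar] with ω hω
    simp only [hΦ]
    rw [integral_const_mul, integral_map hGm.aemeasurable]
    · by_cases hωA : ω ∈ A
      · simp only [hV, hωA, Set.indicator_of_mem, one_mul]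
        exact hf _ (hvs ω) (fun n => hvm n ω) hω
      · simp [hV, hωA]
    · apply Measurable.aestronglyMeasurable
      fun_prop

lemma eexp_eq {Ω : Type*} [MeasurableSpace Ω] (P : Measure Ω) (h : Ω → ℝ) (hi : Integrable h P) :
    eexp P h = ((∫ ω, h ω ∂P : ℝ) : EReal) := by
  rw [integral_eq_lintegral_pos_part_sub_lintegral_neg_part hi]
  unfold eexp
  have h1 : ∫⁻ ω, ENNReal.ofReal (h ω) ∂P ≠ ∞ := hi.lintegral_lt_top.ne
  have h2 : ∫⁻ ω, ENNReal.ofReal (-h ω) ∂P ≠ ∞ := hi.neg.lintegral_lt_top.ne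
  rw [EReal.coe_sub, EReal.coe_ennreal_toReal h1, EReal.coe_ennreal_toReal h2]

lemma eexp_le {Ω : Type*} [MeasurableSpace Ω] (P : Measure Ω) [IsProbabilityMeasure P] (h : Ω → ℝ) (B : ℝ) (hB : 0 ≤ B)
    (hh : ∀ ω, h ω ≤ B) : eexp P h ≤ (B : EReal) := by
  unfold eexp
  have h1 : ∫⁻ ω, ENNReal.ofReal (h ω) ∂P ≤ ENNReal.ofReal B := by
    calc _ ≤ ∫⁻ ω, ENNReal.ofReal B ∂P := lintegral_mono fun ω => ENNReal.ofReal_le_ofReal (hh ω)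
      _ = _ := by simp
  have h2 : ((∫⁻ ω, ENNReal.ofReal (h ω) ∂P : ℝ≥0∞) : EReal) ≤ (B : EReal) := by
    refine (EReal.coe_ennreal_le_coe_ennreal_iff.2 h1).trans ?_
    rw [EReal.coe_ennreal_ofReal, max_eq_left hB]
  calc _ ≤ ((∫⁻ ω, ENNReal.ofReal (h ω) ∂P : ℝ≥0∞) : EReal) - 0 :=
        EReal.sub_le_sub le_rfl (EReal.coe_ennreal_nonneg _)
    _ ≤ _ := by simpa using h2

lemma fbound_real {Ω : Type*} [MeasurableSpace Ω] (P : Measure Ω) [IsProbabilityMeasure P] {N : ℕ}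
    (R : Fin N → Ω → ℝ) (p : Fin N → ℝ) (a m : ℝ) (hR : ∀ n, Measurable (R n))
    (hRs : ∀ ω, (fun n => R n ω) ∈ stdSimplex' N)
    (hp : p ∈ stdSimplex' N) (hm0 : 0 < m) (hm1 : m ≤ 1) (hpm : ∀ n, m ≤ p n)
    (hex : ∃ lam ∈ stdSimplex' N, a ≤ l2norm (fun n => lam n - p n) ∧ ∀ n, m ≤ lam n) :
    ∃ f : ℝ, fbound P R p a = f ∧
      ∀ lam ∈ stdSimplex' N, (∀ n, m ≤ lam n) → a ≤ l2norm (fun n => lam n - p n) →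
      ∫ ω, Real.log (∑ n, lam n / p n * R n ω) ∂P ≤ f := by
  have hp0 : ∀ n, 0 < p n := fun n => hm0.trans_le (hpm n)
  obtain ⟨l0, hl0, hl0a, hl0m⟩ := hex
  have eqn : ∀ (lam : Fin N → ℝ) ω, ∑ n, lam n * R n ω / p n = ∑ n, lam n / p n * R n ω := by
    intro lam ω
    exact Finset.sum_congr rfl fun n _ => by ring
  have hfb : fbound P R p a = sSup {x : EReal | ∃ lam ∈ stdSimplex' N,
      a ≤ l2norm (fun n => lam n - p n) ∧
      x = eexp P (fun ω => Real.log (∑ n, lam n / p n * R n ω))} := by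
    unfold fbound
    rw [if_pos ⟨l0, hl0, hl0a⟩]
    simp_rw [eqn]
  have hlow : ∀ lam ∈ stdSimplex' N, (∀ n, m ≤ lam n) → a ≤ l2norm (fun n => lam n - p n) →
      ((∫ ω, Real.log (∑ n, lam n / p n * R n ω) ∂P : ℝ) : EReal) ≤ fbound P R p a := by
    intro lam hl hlm hla
    rw [hfb]
    apply le_sSup
    refine ⟨lam, hl, hla, (eexp_eq P _ ?_).symm⟩
    refine int_of_bdd P (by fun_prop) (lo := Real.log m) (hi := Real.log (1 / m)) fun ω => ?_
    refine log_avg_bounds (hRs ω) hm0 (fun n => ?_) (fun n => ?_)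
    · rw [le_div_iff₀ (hp0 n)]
      have := simplex_le_one hp n
      have := hlm n
      nlinarith
    · exact div_le_div₀ zero_le_one (simplex_le_one hl n) hm0 (hpm n)
  have hB : 0 ≤ Real.log (1 / m) := Real.log_nonneg (by rw [le_div_iff₀ hm0]; linarith)
  have hup : fbound P R p a ≤ ((Real.log (1 / m) : ℝ) : EReal) := by
    rw [hfb]
    apply sSup_le
    rintro _ ⟨lam, hl, hla, rfl⟩
    apply eexp_le P _ _ hB
    intro ω
    obtain ⟨h1, h2⟩ := avg_bounds (hRs ω) (c := fun n => lam n / p n) (lo := 0) (hi := 1 / m)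
      (fun n => div_nonneg (hl.1 n) (hp0 n).le)
      (fun n => div_le_div₀ zero_le_one (simplex_le_one hl n) hm0 (hpm n))
    rcases h1.eq_or_lt with h | h
    · rw [← h]; simpa using hB
    · exact Real.log_le_log h h2
  have hne1 : fbound P R p a ≠ ⊤ := fun h => by rw [h] at hup; simp at hup
  have hne2 : fbound P R p a ≠ ⊥ := fun h => by
    have := hlow l0 hl0 hl0m hl0a
    rw [h] at this; simp at this
  refine ⟨(fbound P R p a).toReal, (EReal.coe_toReal hne1 hne2).symm, ?_⟩
  intro lam h1 h2 h3
  have := hlow lam h1 h2 h3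
  rw [← EReal.coe_toReal hne1 hne2] at this
  exact_mod_cast this


lemma final_limsup (E1 E2 : ℝ → ℝ≥0∞) (θ D σ C : ℝ) (hθ : 0 < θ) (hD : 0 ≤ D) (hC : 0 < C)
    (H1 : ∀ δ > 0, δ * σ < θ → ∃ C1, ∀ᶠ l in atTop, E1 l ≤ ENNReal.ofReal ((Real.log l + C1) / (θ - δ * σ)))
    (H2 : ∀ δ > 0, ∃ C2, ∀ᶠ l in atTop, ENNReal.ofReal ((Real.log l - C2) / (D + C * δ)) ≤ E2 l) :
    limsup (fun l => E1 l / E2 l) atTop ≤ ENNReal.ofReal (D / θ) := by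
  have hcont : Tendsto (fun δ : ℝ => θ - δ * σ) (nhdsWithin 0 (Set.Ioi 0)) (nhds θ) := by
    have : Continuous fun δ : ℝ => θ - δ * σ := by fun_prop
    have := (this.tendsto 0).mono_left (nhdsWithin_le_nhds (s := Set.Ioi 0))
    simpa using this
  have hcont2 : Tendsto (fun δ : ℝ => D + C * δ) (nhdsWithin 0 (Set.Ioi 0)) (nhds D) := by
    have : Continuous fun δ : ℝ => D + C * δ := by fun_prop
    have := (this.tendsto 0).mono_left (nhdsWithin_le_nhds (s := Set.Ioi 0))
    simpa using this
  refine ge_of_tendsto (ENNReal.tendsto_ofReal (hcont2.div hcont hθ.ne')) ?_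
  filter_upwards [hcont.eventually (lt_mem_nhds hθ), self_mem_nhdsWithin] with δ h1 hδ
  have hδ : 0 < δ := hδ
  obtain ⟨C1, hC1⟩ := H1 δ hδ (by linarith)
  obtain ⟨C2, hC2⟩ := H2 δ hδ
  have hDp : 0 < D + C * δ := by positivity
  have hlim : Tendsto (fun l : ℝ => ENNReal.ofReal (((Real.log l + C1) / (θ - δ * σ)) / ((Real.log l - C2) / (D + C * δ)))) atTop
      (nhds (ENNReal.ofReal ((D + C * δ) / (θ - δ * σ)))) := by
    apply ENNReal.tendsto_ofReal
    have h3 : Tendsto (fun y : ℝ => (C1 + C2) / (y - C2)) atTop (nhds 0) :=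
      Tendsto.div_atTop tendsto_const_nhds (tendsto_atTop_add_const_right _ _ tendsto_id)
    have h4 : Tendsto (fun y : ℝ => (1 + (C1 + C2) / (y - C2)) * ((D + C * δ) / (θ - δ * σ))) atTop
        (nhds ((1 + 0) * ((D + C * δ) / (θ - δ * σ)))) := (h3.const_add 1).mul_const _
    rw [add_zero, one_mul] at h4
    refine (h4.comp Real.tendsto_log_atTop).congr' ?_
    filter_upwards [Real.tendsto_log_atTop.eventually (eventually_gt_atTop C2)] with l hl
    have : Real.log l - C2 ≠ 0 := by linarith
    simp only [Function.comp]
    field_simp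
    ring
  show _ ≤ ENNReal.ofReal ((D + C * δ) / (θ - δ * σ))
  rw [← hlim.limsup_eq]
  refine limsup_le_limsup ?_
  filter_upwards [hC1, hC2, Real.tendsto_log_atTop.eventually (eventually_gt_atTop C2)] with l a1 a2 a3
  rw [ENNReal.ofReal_div_of_pos (div_pos (by linarith) hDp)]
  exact ENNReal.div_le_div a1 a2

lemma notYet_log {Ω : Type*} (Y : ℕ → Ω → ℝ) (hY : ∀ t ω, 0 < Y t ω) (l : ℝ) (hl : 0 < l) (t : ℕ) :
    notYet (fun t ω => Real.log (Y t ω)) (Real.log l) t = notYet Y l t := by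
  ext ω
  refine forall_congr' fun s => forall_congr' fun _ => ?_
  exact Real.log_lt_log_iff (hY s ω) hl

/-- Theorem 2: with `M = 2` and Assumptions A and B, if investor 1 uses the constant
strategy `λ*ⁿ = E R₁ⁿ` and investor 2 uses a strategy whose realization satisfies
`‖λ̃ₜ − λ*‖ ≥ a` a.s. and `λ̃ₜⁿ > ε̃ > 0`, then, with `θ = E ln ρ₁ > 0`,
`limsup_{l→∞} (E τₗ¹)/(E τₗ²) ≤ 1 − (|f(a)| ∧ θ)/θ`. -/
theorem strict_expected_hitting_time_advantage
    {Ω : Type*} {m0 : MeasurableSpace Ω} (P : Measure Ω) [IsProbabilityMeasure P]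
    (ℱ : Filtration ℕ m0) {N : ℕ} (hN : 2 ≤ N)
    -- Assumption (A.1): the growth factors ρₜ
    (ρ : ℕ → Ω → ℝ)
    (hρ_adapted : ∀ t, StronglyMeasurable[ℱ (t + 1)] (ρ (t + 1)))
    (hρ_pos : ∀ t ω, 0 < ρ (t + 1) ω)
    (hρ_ident : ∀ t, IdentDistrib (ρ (t + 1)) (ρ 1) P P)
    (hρ_indep : ∀ t, Indep (MeasurableSpace.comap (ρ (t + 1)) inferInstance) (ℱ t) P)
    (hρ_L2 : Integrable (fun ω => (Real.log (ρ 1 ω)) ^ 2) P)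
    (hρ_growth : 0 < ∫ ω, Real.log (ρ 1 ω) ∂P)
    -- Assumption (A.2): the relative payoffs Rₜ
    (R : ℕ → Fin N → Ω → ℝ) (ε : ℝ) (hε : 0 < ε)
    (hR_adapted : ∀ t n, StronglyMeasurable[ℱ (t + 1)] (R (t + 1) n))
    (hR_simplex : ∀ t ω, (fun n => R (t + 1) n ω) ∈ stdSimplex' N)
    (hR_cond : ∀ t n, ∀ᵐ ω ∂P, ε ≤ (P[R (t + 1) n | ℱ t]) ω)
    -- Assumption (B.1): the Rₜ are identically distributed and independent of F_{t-1}
    (hR_ident : ∀ t, IdentDistrib (fun ω n => R (t + 1) n ω) (fun ω n => R 1 n ω) P P)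
    (hR_indep : ∀ t, Indep (MeasurableSpace.comap (fun ω n => R (t + 1) n ω)
      inferInstance) (ℱ t) P)
    -- Assumption (B.2): linearly independent components
    (hR_linind : ∀ c : Fin N → ℝ, (∀ᵐ ω ∂P, ∑ n, c n * R 1 n ω = 0) → c = 0)
    -- initial wealths
    (Y10 Y20 : ℝ) (hY10 : 0 < Y10) (hY20 : 0 < Y20)
    -- investor 1 uses the constant strategy λ*ⁿ = E R₁ⁿ
    (lamstar : Fin N → ℝ) (hstar : ∀ n, lamstar n = ∫ ω, R 1 n ω ∂P)
    -- investor 2 uses an adapted Δ-valued strategy λ̃ₜ with ‖λ̃ₜ − λ*‖ ≥ a, λ̃ₜⁿ > ε̃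
    (tlam : ℕ → Fin N → Ω → ℝ)
    (htlam_adapted : ∀ t n, StronglyMeasurable[ℱ t] (tlam (t + 1) n))
    (htlam_simplex : ∀ t ω, (fun n => tlam (t + 1) n ω) ∈ stdSimplex' N)
    (a : ℝ) (ha : 0 < a)
    (hfar : ∀ t : ℕ, ∀ᵐ ω ∂P, a ≤ l2norm (fun n => tlam (t + 1) n ω - lamstar n))
    (εt : ℝ) (hεt : 0 < εt) (htlam_pos : ∀ t n ω, εt < tlam (t + 1) n ω)
    -- the payoffs, generated as in Assumption A
    (X : ℕ → Fin N → Ω → ℝ)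
    (hX1 : ∀ n ω, X 1 n ω = ρ 1 ω * R 1 n ω * (Y10 + Y20))
    (hXt : ∀ t n ω, X (t + 2) n ω = ρ (t + 2) ω * R (t + 2) n ω * ∑ i, X (t + 1) i ω)
    -- the wealth dynamics of the two investors
    (Y1 Y2 : ℕ → Ω → ℝ)
    (hY1init : ∀ ω, Y1 0 ω = Y10) (hY2init : ∀ ω, Y2 0 ω = Y20)
    (hY1rec : ∀ t ω, Y1 (t + 1) ω = ∑ n,
      lamstar n * Y1 t ω / (lamstar n * Y1 t ω + tlam (t + 1) n ω * Y2 t ω) *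
        X (t + 1) n ω)
    (hY2rec : ∀ t ω, Y2 (t + 1) ω = ∑ n,
      tlam (t + 1) n ω * Y2 t ω / (lamstar n * Y1 t ω + tlam (t + 1) n ω * Y2 t ω) *
        X (t + 1) n ω) :
    Filter.limsup
      (fun l : ℝ => (∫⁻ ω, hitTime Y1 l ω ∂P) / (∫⁻ ω, hitTime Y2 l ω ∂P))
      Filter.atTop ≤
      ENNReal.ofReal (1 -
        (min (-(fbound P (fun n ω => R 1 n ω) lamstar a))
          ((∫ ω, Real.log (ρ 1 ω) ∂P : ℝ) : EReal)).toReal /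
          (∫ ω, Real.log (ρ 1 ω) ∂P)) := by
  have hle : ∀ t, ℱ t ≤ m0 := ℱ.le
  have hRm1 : ∀ t n, Measurable[ℱ (t+1)] (R (t+1) n) := fun t n => (hR_adapted t n).measurable
  have hRm : ∀ t n, Measurable (R (t+1) n) := fun t n => (hRm1 t n).mono (hle _) le_rfl
  have hρm1 : ∀ t, Measurable[ℱ (t+1)] (ρ (t+1)) := fun t => (hρ_adapted t).measurable
  have hρm : ∀ t, Measurable (ρ (t+1)) := fun t => (hρm1 t).mono (hle _) le_rfl
  have hvm1 : ∀ t n, Measurable[ℱ t] (tlam (t+1) n) := fun t n => (htlam_adapted t n).measurable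
  have hvm : ∀ t n, Measurable (tlam (t+1) n) := fun t n => (hvm1 t n).mono (hle _) le_rfl
  have hRint : ∀ t n, Integrable (R (t+1) n) P := fun t n =>
    int_of_bdd P (hRm t n) (lo := 0) (hi := 1) fun ω => ⟨(hR_simplex t ω).1 n, simplex_le_one (hR_simplex t ω) n⟩
  -- lamstar
  have hpε : ∀ n, ε ≤ lamstar n := by
    intro n
    rw [hstar, ← integral_condExp (hle 0)]
    calc ε = ∫ ω, ε ∂P := by simp
      _ ≤ _ := integral_mono_ae (integrable_const _) integrable_condExp (hR_cond 0 n)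
  have hps : lamstar ∈ stdSimplex' N := by
    refine ⟨fun n => hε.le.trans (hpε n), ?_⟩
    simp_rw [hstar]
    rw [← integral_finsetSum _ fun n _ => hRint 0 n]
    have : ∀ ω, ∑ n, R 1 n ω = 1 := fun ω => (hR_simplex 0 ω).2
    simp [this]
  have hRp : ∀ t n, ∫ ω, R (t+1) n ω ∂P = lamstar n := by
    intro t n
    rw [hstar]
    exact ((hR_ident t).comp (measurable_pi_apply n)).integral_eq
  set m : ℝ := min ε εt with hmdef
  have hm0 : 0 < m := lt_min hε hεt
  have hpm : ∀ n, m ≤ lamstar n := fun n => (min_le_left _ _).trans (hpε n)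
  have hvmin : ∀ t n ω, m ≤ tlam (t+1) n ω := fun t n ω => (min_le_right _ _).trans (htlam_pos t n ω).le
  have hm1 : m ≤ 1 := (hpm ⟨0, by omega⟩).trans (simplex_le_one hps _)
  have hp0 : ∀ n, 0 < lamstar n := fun n => hm0.trans_le (hpm n)
  have hv0 : ∀ t n ω, 0 < tlam (t+1) n ω := fun t n ω => hm0.trans_le (hvmin t n ω)
  have hX0 : ∀ t, (∀ ω, 0 < Y1 t ω ∧ 0 < Y2 t ω) → (∀ n ω, X (t+1) n ω = ρ (t+1) ω * R (t+1) n ω * (Y1 t ω + Y2 t ω)) →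
      (∀ ω, Y1 (t+1) ω = Y1 t ω * ρ (t+1) ω * ∑ n, lamstar n / ((lamstar n * Y1 t ω + tlam (t + 1) n ω * Y2 t ω) / (Y1 t ω + Y2 t ω)) * R (t+1) n ω) ∧
      (∀ ω, Y2 (t+1) ω = Y2 t ω * ρ (t+1) ω * ∑ n, tlam (t+1) n ω / ((lamstar n * Y1 t ω + tlam (t + 1) n ω * Y2 t ω) / (Y1 t ω + Y2 t ω)) * R (t+1) n ω) ∧
      (∀ ω, ∑ n, X (t+1) n ω = Y1 (t+1) ω + Y2 (t+1) ω) := by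
    intro t hpos hX
    refine ⟨fun ω => ?_, fun ω => ?_, fun ω => ?_⟩
    · rw [hY1rec, Finset.mul_sum]
      refine Finset.sum_congr rfl fun n _ => ?_
      have h1 := (hpos ω).1
      have h2 := (hpos ω).2
      have h3 := hp0 n
      have h4 := hv0 t n ω
      have : 0 < lamstar n * Y1 t ω + tlam (t + 1) n ω * Y2 t ω := by positivity
      rw [hX]
      field_simp
    · rw [hY2rec, Finset.mul_sum]
      refine Finset.sum_congr rfl fun n _ => ?_
      have h1 := (hpos ω).1
      have h2 := (hpos ω).2
      have h3 := hp0 n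
      have h4 := hv0 t n ω
      have : 0 < lamstar n * Y1 t ω + tlam (t + 1) n ω * Y2 t ω := by positivity
      rw [hX]
      field_simp
    · rw [hY1rec, hY2rec, ← Finset.sum_add_distrib]
      refine Finset.sum_congr rfl fun n _ => ?_
      have h1 := (hpos ω).1
      have h2 := (hpos ω).2
      have h3 := hp0 n
      have h4 := hv0 t n ω
      have : 0 < lamstar n * Y1 t ω + tlam (t + 1) n ω * Y2 t ω := by positivity
      rw [← add_mul, ← add_div, div_self this.ne', one_mul]
  set w : ℕ → Fin N → Ω → ℝ := fun t n ω => (lamstar n * Y1 t ω + tlam (t + 1) n ω * Y2 t ω) / (Y1 t ω + Y2 t ω) with hwdef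
  set u : ℕ → Ω → ℝ := fun t ω => Y2 t ω / (Y1 t ω + Y2 t ω) with hudef
  have hw_of : ∀ t ω, 0 < Y1 t ω → 0 < Y2 t ω → (0 < u t ω ∧ u t ω < 1 ∧ (fun n => w t n ω) ∈ stdSimplex' N ∧ (∀ n, m ≤ w t n ω) ∧
      ∀ n, w t n ω = lamstar n + u t ω * (tlam (t+1) n ω - lamstar n)) := by
    intro t ω h1 h2
    have hu0 : 0 < u t ω := by simp only [hudef]; positivity
    have hu1 : u t ω < 1 := by simp only [hudef]; rw [div_lt_one (by positivity)]; linarith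
    have hwe : ∀ n, w t n ω = lamstar n + u t ω * (tlam (t+1) n ω - lamstar n) := by
      intro n
      simp only [hwdef, hudef]
      field_simp
      ring
    have hwm : ∀ n, m ≤ w t n ω := by
      intro n
      rw [hwe]
      nlinarith [hpm n, hvmin t n ω]
    refine ⟨hu0, hu1, ⟨fun n => hm0.le.trans (hwm n), ?_⟩, hwm, hwe⟩
    simp_rw [hwe]
    rw [Finset.sum_add_distrib, ← Finset.mul_sum, Finset.sum_sub_distrib, hps.2, (htlam_simplex t ω).2]
    ring
  have hcpos : ∀ t ω (c : Fin N → ℝ), (∀ n, m ≤ c n) → 0 < Y1 t ω → 0 < Y2 t ω → (∀ n, c n ≤ 1) →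
      (∀ n, m ≤ c n / w t n ω) ∧ (∀ n, c n / w t n ω ≤ 1 / m) := by
    intro t ω c hc h1 h2 hc1
    obtain ⟨_, _, hs, hwm, _⟩ := hw_of t ω h1 h2
    refine ⟨fun n => ?_, fun n => div_le_div₀ zero_le_one (hc1 n) hm0 (hwm n)⟩
    rw [le_div_iff₀ (hm0.trans_le (hwm n))]
    have := simplex_le_one hs n
    have := hc n
    nlinarith
  have main : ∀ t, (∀ ω, 0 < Y1 t ω ∧ 0 < Y2 t ω) ∧ (∀ n ω, X (t+1) n ω = ρ (t+1) ω * R (t+1) n ω * (Y1 t ω + Y2 t ω)) := by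
    intro t
    induction t with
    | zero =>
      refine ⟨fun ω => ?_, fun n ω => ?_⟩
      · rw [hY1init, hY2init]; exact ⟨hY10, hY20⟩
      · rw [hY1init, hY2init]; exact hX1 n ω
    | succ t ih =>
      obtain ⟨h1, h2, h3⟩ := hX0 t ih.1 ih.2
      refine ⟨fun ω => ?_, fun n ω => ?_⟩
      · obtain ⟨a1, a2⟩ := ih.1 ω
        have r0 := hρ_pos t ω
        obtain ⟨b1, b2⟩ := hcpos t ω lamstar hpm a1 a2 (simplex_le_one hps)
        obtain ⟨c1, c2⟩ := hcpos t ω (fun n => tlam (t+1) n ω) (fun n => hvmin t n ω) a1 a2 (simplex_le_one (htlam_simplex t ω))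
        rw [h1, h2]
        exact ⟨mul_pos (mul_pos a1 r0) (hm0.trans_le (avg_bounds (hR_simplex t ω) b1 b2).1),
          mul_pos (mul_pos a2 r0) (hm0.trans_le (avg_bounds (hR_simplex t ω) c1 c2).1)⟩
      · rw [hXt, h3]
  have hYpos := fun t => (main t).1
  have hYX := fun t => (main t).2
  set x : ℕ → Ω → ℝ := fun t ω => Real.log (ρ (t+1) ω) with hxdef
  set q : ℕ → Ω → ℝ := fun t ω => Real.log (∑ n, lamstar n / w t n ω * R (t+1) n ω) with hqdef
  set p : ℕ → Ω → ℝ := fun t ω => Real.log (∑ n, tlam (t+1) n ω / w t n ω * R (t+1) n ω) with hpdef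
  have hqb : ∀ t ω, Real.log m ≤ q t ω ∧ q t ω ≤ Real.log (1 / m) := by
    intro t ω
    obtain ⟨b1, b2⟩ := hcpos t ω lamstar hpm (hYpos t ω).1 (hYpos t ω).2 (simplex_le_one hps)
    exact log_avg_bounds (hR_simplex t ω) hm0 b1 b2
  have hpb : ∀ t ω, Real.log m ≤ p t ω ∧ p t ω ≤ Real.log (1 / m) := by
    intro t ω
    obtain ⟨b1, b2⟩ := hcpos t ω (fun n => tlam (t+1) n ω) (fun n => hvmin t n ω) (hYpos t ω).1 (hYpos t ω).2 (simplex_le_one (htlam_simplex t ω))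
    exact log_avg_bounds (hR_simplex t ω) hm0 b1 b2
  have hL1 : ∀ t ω, Real.log (Y1 (t+1) ω) = Real.log (Y1 t ω) + x t ω + q t ω := by
    intro t ω
    rw [(hX0 t (hYpos t) (hYX t)).1 ω]
    obtain ⟨b1, b2⟩ := hcpos t ω lamstar hpm (hYpos t ω).1 (hYpos t ω).2 (simplex_le_one hps)
    have := hm0.trans_le (avg_bounds (hR_simplex t ω) b1 b2).1
    rw [Real.log_mul (mul_pos (hYpos t ω).1 (hρ_pos t ω)).ne' this.ne', Real.log_mul (hYpos t ω).1.ne' (hρ_pos t ω).ne']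
  have hL2 : ∀ t ω, Real.log (Y2 (t+1) ω) = Real.log (Y2 t ω) + x t ω + p t ω := by
    intro t ω
    rw [(hX0 t (hYpos t) (hYX t)).2.1 ω]
    obtain ⟨b1, b2⟩ := hcpos t ω (fun n => tlam (t+1) n ω) (fun n => hvmin t n ω) (hYpos t ω).1 (hYpos t ω).2 (simplex_le_one (htlam_simplex t ω))
    have := hm0.trans_le (avg_bounds (hR_simplex t ω) b1 b2).1
    rw [Real.log_mul (mul_pos (hYpos t ω).2 (hρ_pos t ω)).ne' this.ne', Real.log_mul (hYpos t ω).2.ne' (hρ_pos t ω).ne']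
  have hW : ∀ t ω, Y1 (t+1) ω + Y2 (t+1) ω = ρ (t+1) ω * (Y1 t ω + Y2 t ω) := by
    intro t ω
    rw [← (hX0 t (hYpos t) (hYX t)).2.2 ω]
    simp_rw [hYX]
    rw [← Finset.sum_mul, ← Finset.mul_sum, (hR_simplex t ω).2, mul_one]
  -- measurability
  have hYm : ∀ t, Measurable[ℱ t] (Y1 t) ∧ Measurable[ℱ t] (Y2 t) := by
    intro t
    induction t with
    | zero =>
      have e1 : Y1 0 = fun _ => Y10 := funext hY1init
      have e2 : Y2 0 = fun _ => Y20 := funext hY2init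
      rw [e1, e2]
      exact ⟨measurable_const, measurable_const⟩
    | succ t ih =>
      have i1 : Measurable[ℱ (t+1)] (Y1 t) := ih.1.mono (ℱ.mono (Nat.le_succ t)) le_rfl
      have i2 : Measurable[ℱ (t+1)] (Y2 t) := ih.2.mono (ℱ.mono (Nat.le_succ t)) le_rfl
      have i3 : ∀ n, Measurable[ℱ (t+1)] (tlam (t+1) n) := fun n => (hvm1 t n).mono (ℱ.mono (Nat.le_succ t)) le_rfl
      have i4 := hRm1 t
      have i5 := hρm1 t
      have e1 : Y1 (t+1) = _ := funext (hX0 t (hYpos t) (hYX t)).1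
      have e2 : Y2 (t+1) = _ := funext (hX0 t (hYpos t) (hYX t)).2.1
      rw [e1, e2]
      constructor <;> fun_prop
  have hwm1 : ∀ t n, Measurable[ℱ t] (w t n) := by
    intro t n
    have := (hYm t).1
    have := (hYm t).2
    have := hvm1 t n
    simp only [hwdef]
    fun_prop
  have hwm : ∀ t n, Measurable (w t n) := fun t n => (hwm1 t n).mono (hle t) le_rfl
  have hum : ∀ t, Measurable (u t) := by
    intro t
    have := (hYm t).1.mono (hle t) le_rfl
    have := (hYm t).2.mono (hle t) le_rfl
    simp only [hudef]
    fun_prop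
  have hqi : ∀ t, Integrable (q t) P := fun t =>
    int_of_bdd P (by have := hwm t; have := hRm t; simp only [hqdef]; fun_prop) (hqb t)
  have hpi : ∀ t, Integrable (p t) P := fun t =>
    int_of_bdd P (by have := hwm t; have := hRm t; have := hvm t; simp only [hpdef]; fun_prop) (hpb t)
  have hub : ∀ t ω, 0 < u t ω ∧ u t ω < 1 := fun t ω =>
    ⟨(hw_of t ω (hYpos t ω).1 (hYpos t ω).2).1, (hw_of t ω (hYpos t ω).1 (hYpos t ω).2).2.1⟩
  have hui : ∀ t, Integrable (u t) P := fun t =>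
    int_of_bdd P (hum t) (lo := 0) (hi := 1) fun ω => ⟨(hub t ω).1.le, (hub t ω).2.le⟩
  have hu2i : ∀ t, Integrable (fun ω => u t ω ^ 2) P := fun t =>
    int_of_bdd P ((hum t).pow_const 2) (lo := 0) (hi := 1) fun ω =>
      ⟨sq_nonneg _, pow_le_one₀ (hub t ω).1.le (hub t ω).2.le⟩
  -- x
  have hx0i : Integrable (fun ω => Real.log (ρ 1 ω)) P := by
    have : MemLp (fun ω => Real.log (ρ 1 ω)) 2 P :=
      (memLp_two_iff_integrable_sq (by have := hρm 0; exact (Real.measurable_log.comp this).aestronglyMeasurable)).2 hρ_L2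
    exact this.integrable (by norm_num)
  have hxid : ∀ t, IdentDistrib (x t) (fun ω => Real.log (ρ 1 ω)) P P := fun t =>
    (hρ_ident t).comp Real.measurable_log
  have hx2id : ∀ t, IdentDistrib (fun ω => x t ω ^ 2) (fun ω => Real.log (ρ 1 ω) ^ 2) P P := fun t =>
    (hxid t).comp (measurable_id.pow_const 2)
  have hxaid : ∀ t, IdentDistrib (fun ω => |x t ω|) (fun ω => |Real.log (ρ 1 ω)|) P P := fun t =>
    (hxid t).comp measurable_norm
  have hxi : ∀ t, Integrable (x t) P := fun t => (hxid t).integrable_iff.2 hx0i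
  have hx2i : ∀ t, Integrable (fun ω => x t ω ^ 2) P := fun t => (hx2id t).integrable_iff.2 hρ_L2
  set θ : ℝ := ∫ ω, Real.log (ρ 1 ω) ∂P with hθ
  set σ : ℝ := ∫ ω, Real.log (ρ 1 ω) ^ 2 ∂P with hσ
  set κ : ℝ := ∫ ω, |Real.log (ρ 1 ω)| ∂P with hκ
  have hx1 : ∀ t A, MeasurableSet[ℱ t] A → ∫ ω in A, x t ω ∂P = θ * P.real A := by
    intro t A hA
    rw [hθ, ← (hxid t).integral_eq]
    exact indep_set P (hle t) (ρ (t+1)) (hρm t) (hρ_indep t) Real.log Real.measurable_log A hA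
  have hx2 : ∀ t A, MeasurableSet[ℱ t] A → ∫ ω in A, x t ω ^ 2 ∂P = σ * P.real A := by
    intro t A hA
    rw [hσ, ← (hx2id t).integral_eq]
    exact indep_set P (hle t) (ρ (t+1)) (hρm t) (hρ_indep t) (fun y => Real.log y ^ 2) (Real.measurable_log.pow_const 2) A hA
  have hx3 : ∀ t A, MeasurableSet[ℱ t] A → ∫ ω in A, |x t ω| ∂P = κ * P.real A := by
    intro t A hA
    rw [hκ, ← (hxaid t).integral_eq]
    exact indep_set P (hle t) (ρ (t+1)) (hρm t) (hρ_indep t) (fun y => |Real.log y|) (measurable_norm.comp Real.measurable_log) A hA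
  -- Kullback-Leibler
  have hkl : ∀ t A, MeasurableSet[ℱ t] A → ∫ ω in A, (∑ n, (lamstar n - w t n ω) ^ 2) / 4 ∂P ≤ ∫ ω in A, q t ω ∂P := by
    intro t A hA
    exact kl_int P (hle t) lamstar (R (t+1)) (w t) (hRm t) (hR_indep t) (hR_simplex t) (hRp t) hps hm0 hpm
      (hwm1 t) (fun ω => (hw_of t ω (hYpos t ω).1 (hYpos t ω).2).2.2.1)
      (fun n ω => (hw_of t ω (hYpos t ω).1 (hYpos t ω).2).2.2.2.1 n) A hA
  have hq0 : ∀ t A, MeasurableSet[ℱ t] A → 0 ≤ ∫ ω in A, q t ω ∂P := by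
    intro t A hA
    refine le_trans ?_ (hkl t A hA)
    exact integral_nonneg fun ω => div_nonneg (Finset.sum_nonneg fun n _ => sq_nonneg _) (by norm_num)
  have hqu : ∀ t, a ^ 2 / 4 * ∫ ω, u t ω ^ 2 ∂P ≤ ∫ ω, q t ω ∂P := by
    intro t
    have h := hkl t Set.univ MeasurableSet.univ
    rw [setIntegral_univ, setIntegral_univ] at h
    refine le_trans ?_ h
    rw [← integral_const_mul]
    apply integral_mono_ae ((hu2i t).const_mul _)
    · apply Integrable.div_const
      apply integrable_finsetSum
      intro n _
      refine int_of_bdd P (by have := hwm t n; fun_prop) (lo := 0) (hi := 1) fun ω => ⟨sq_nonneg _, ?_⟩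
      obtain ⟨_, _, hs, hwm', _⟩ := hw_of t ω (hYpos t ω).1 (hYpos t ω).2
      have h1 := simplex_le_one hs n
      have h2 := simplex_le_one hps n
      have h3 := hwm' n
      have h4 := hp0 n
      rw [sq_le_one_iff_abs_le_one, abs_le]
      constructor <;> linarith
    · filter_upwards [hfar t] with ω hω
      obtain ⟨_, _, _, _, hwe⟩ := hw_of t ω (hYpos t ω).1 (hYpos t ω).2
      have h1 : ∑ n, (lamstar n - w t n ω) ^ 2 = u t ω ^ 2 * ∑ n, (tlam (t+1) n ω - lamstar n) ^ 2 := by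
        rw [Finset.mul_sum]
        refine Finset.sum_congr rfl fun n _ => ?_
        rw [hwe]; ring
      have h2 : a ^ 2 ≤ ∑ n, (tlam (t+1) n ω - lamstar n) ^ 2 := by
        unfold l2norm at hω
        exact (Real.le_sqrt' ha).1 hω
      show a ^ 2 / 4 * u t ω ^ 2 ≤ (∑ n, (lamstar n - w t n ω) ^ 2) / 4
      rw [h1]
      nlinarith [sq_nonneg (u t ω)]
  -- sum of q
  set r0 : ℝ := Real.log (Y10 + Y20) - Real.log Y10 with hr0
  have hqsum : ∀ T, ∑ t ∈ Finset.range T, ∫ ω, q t ω ∂P ≤ r0 := by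
    intro T
    rw [← integral_finsetSum _ fun t _ => hqi t]
    have hpt : ∀ ω, ∑ t ∈ Finset.range T, q t ω ≤ r0 := by
      intro ω
      have e : ∑ t ∈ Finset.range T, q t ω = (Real.log (Y1 T ω) - Real.log (Y1 T ω + Y2 T ω)) + r0 := by
        induction T with
        | zero => simp [hY1init, hY2init, hr0]
        | succ T ih =>
          rw [Finset.sum_range_succ, ih, hL1, hW, Real.log_mul (hρ_pos T ω).ne' (add_pos (hYpos T ω).1 (hYpos T ω).2).ne']
          simp only [hxdef]; ring
      rw [e]
      have := Real.log_le_log (hYpos T ω).1 (le_add_of_nonneg_right (a := Y1 T ω) (hYpos T ω).2.le)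
      linarith
    calc _ ≤ ∫ ω, r0 ∂P := integral_mono (integrable_finsetSum _ fun t _ => hqi t) (integrable_const _) hpt
      _ = r0 := by simp
  have hK : ∀ T, ∑ t ∈ Finset.range T, ∫ ω, u t ω ^ 2 ∂P ≤ r0 / (a ^ 2 / 4) := by
    intro T
    rw [le_div_iff₀ (by positivity), mul_comm, Finset.mul_sum]
    exact (Finset.sum_le_sum fun t _ => hqu t).trans (hqsum T)
  -- f
  obtain ⟨f, hfe, hf⟩ := fbound_real P (fun n ω => R 1 n ω) lamstar a m (hRm 0) (hR_simplex 0) hps hm0 hm1 hpm (by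
    obtain ⟨ω, hω⟩ := (hfar 0).exists
    exact ⟨_, htlam_simplex 0 ω, hω, fun n => hvmin 0 n ω⟩)
  have hf' : ∀ t, ∀ lam ∈ stdSimplex' N, (∀ n, m ≤ lam n) → a ≤ l2norm (fun n => lam n - lamstar n) →
      ∫ ω, Real.log (∑ n, lam n / lamstar n * R (t+1) n ω) ∂P ≤ f := by
    intro t lam h1 h2 h3
    have hm' : Measurable fun r : Fin N → ℝ => Real.log (∑ n, lam n / lamstar n * r n) := by fun_prop
    have := ((hR_ident t).comp hm').integral_eq
    simp only [Function.comp_def] at this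
    rw [this]
    exact hf lam h1 h2 h3
  have hpu : ∀ t A, MeasurableSet[ℱ t] A → ∫ ω in A, p t ω ∂P ≤ f * P.real A + 1 / m * ∫ ω in A, u t ω ∂P := by
    intro t A hA
    have h1 := f_int P (hle t) lamstar (R (t+1)) (tlam (t+1)) (hRm t) (hR_indep t) (hR_simplex t) hps hm0 hpm
      (hvm1 t) (htlam_simplex t) (hvmin t) (hfar t) (hf' t) A hA
    have hi : Integrable (fun ω => Real.log (∑ n, tlam (t+1) n ω / lamstar n * R (t+1) n ω)) P := by
      refine int_of_bdd P (by have := hRm t; have := hvm t; fun_prop) (lo := Real.log m) (hi := Real.log (1 / m)) fun ω => ?_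
      refine log_avg_bounds (hR_simplex t ω) hm0 (fun n => ?_) (fun n => ?_)
      · rw [le_div_iff₀ (hp0 n)]
        have := simplex_le_one hps n
        have := hvmin t n ω
        nlinarith
      · exact div_le_div₀ zero_le_one (simplex_le_one (htlam_simplex t ω) n) hm0 (hpm n)
    calc ∫ ω in A, p t ω ∂P ≤ ∫ ω in A, (Real.log (∑ n, tlam (t+1) n ω / lamstar n * R (t+1) n ω) + 1 / m * u t ω) ∂P := by
          apply integral_mono (hpi t).integrableOn (hi.integrableOn.add ((hui t).integrableOn.const_mul _))
          intro ω
          obtain ⟨_, _, _, hwm', hwe⟩ := hw_of t ω (hYpos t ω).1 (hYpos t ω).2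
          have := log_compare (hR_simplex t ω) (fun n => hv0 t n ω) hp0 (simplex_le_one hps) hm0 hwm' (hub t ω).1.le hwe
          show p t ω ≤ Real.log (∑ n, tlam (t+1) n ω / lamstar n * R (t+1) n ω) + 1 / m * u t ω
          rw [one_div_mul_eq_div]
          exact this
      _ = _ := by
          rw [integral_add hi.integrableOn ((hui t).integrableOn.const_mul _), integral_const_mul]
      _ ≤ _ := by linarith
  -- events
  have hAm : ∀ (Y : ℕ → Ω → ℝ), (∀ t, Measurable[ℱ t] (Y t)) → ∀ l t, MeasurableSet[ℱ t] (notYet Y l t) := by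
    intro Y hY l t
    have : notYet Y l t = ⋂ s, ⋂ (_ : s ≤ t), {ω | Y s ω < l} := by
      ext ω; simp [notYet]
    rw [this]
    refine MeasurableSet.iInter fun s => MeasurableSet.iInter fun hs => ?_
    exact ℱ.mono hs _ (measurableSet_lt (hY s) measurable_const)
  have hA1 := hAm Y1 (fun t => (hYm t).1)
  have hA2 := hAm Y2 (fun t => (hYm t).2)
  have hBnn : 0 ≤ Real.log (1 / m) := Real.log_nonneg (by rw [le_div_iff₀ hm0]; linarith)
  have hlogm : Real.log (1 / m) = - Real.log m := by rw [one_div, Real.log_inv]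
  -- rewrite the target
  have hD : ENNReal.ofReal (1 -
        (min (-(fbound P (fun n ω => R 1 n ω) lamstar a)) (θ : EReal)).toReal / θ) =
      ENNReal.ofReal (max (θ + f) 0 / θ) := by
    rw [hfe, ← EReal.coe_neg, ← EReal.coe_strictMono.monotone.map_min, EReal.toReal_coe]
    congr 1
    rw [eq_div_iff hρ_growth.ne', sub_mul, div_mul_cancel₀ _ hρ_growth.ne']
    rcases le_total (-f) θ with h | h
    · rw [min_eq_left h, max_eq_left (by linarith)]; ring
    · rw [min_eq_right h, max_eq_right (by linarith)]; ring
  rw [hD]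
  refine final_limsup _ _ θ (max (θ + f) 0) σ (1 / m) hρ_growth (le_max_right _ _) (by positivity) ?_ ?_
  · intro δ hδ hδσ
    refine ⟨-Real.log Y10 + Real.log (1 / m) + 1 / (4 * δ), ?_⟩
    filter_upwards [eventually_ge_atTop Y10] with l hl
    have hl0 : 0 < l := hY10.trans_le hl
    rw [lintegral_hitTime P Y1 l fun t => hle t _ (hA1 l t)]
    have hny := notYet_log Y1 (fun t ω => (hYpos t ω).1) l hl0
    rw [ENNReal.tsum_eq_iSup_nat]
    refine iSup_le fun T => ?_
    have key := upper_aux P (fun t ω => Real.log (Y1 t ω)) x q (Real.log l) (Real.log Y10) (Real.log (1 / m)) θ σ δ hδ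
      hBnn (Real.log_le_log hY10 hl) (fun ω => by rw [hY1init]) hL1
      (fun t => by rw [hny]; exact hle t _ (hA1 l t)) (fun t ω => (hqb t ω).2) hxi hx2i hqi
      (fun t => by rw [hny]; exact hx1 t _ (hA1 l t)) (fun t => by rw [hny]; exact hx2 t _ (hA1 l t))
      (fun t => by rw [hny]; exact hq0 t _ (hA1 l t)) T
    simp_rw [hny] at key
    have e : ∑ t ∈ Finset.range T, P (notYet Y1 l t) = ENNReal.ofReal (∑ t ∈ Finset.range T, P.real (notYet Y1 l t)) := by
      rw [ENNReal.ofReal_sum_of_nonneg fun t _ => measureReal_nonneg]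
      exact Finset.sum_congr rfl fun t _ => (ofReal_measureReal).symm
    rw [e]
    apply ENNReal.ofReal_le_ofReal
    rw [le_div_iff₀ (by linarith)]
    linarith
  · intro δ hδ
    refine ⟨Real.log Y20 + 1 / m * ((r0 / (a ^ 2 / 4)) / δ), ?_⟩
    filter_upwards [eventually_gt_atTop 0] with l hl0
    rw [lintegral_hitTime P Y2 l fun t => hle t _ (hA2 l t)]
    have hny := notYet_log Y2 (fun t ω => (hYpos t ω).2) l hl0
    have e0 : ∀ t, P (notYet Y2 l t) = ENNReal.ofReal (P.real (notYet Y2 l t)) := fun t => (ofReal_measureReal).symm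
    by_cases hs : Summable fun t => P.real (notYet Y2 l t)
    · have key := lower_aux P (fun t ω => Real.log (Y2 t ω)) x p u (Real.log l) (Real.log Y20) (1 / m) (Real.log (1 / m)) θ κ f
        (r0 / (a ^ 2 / 4)) δ hδ (by positivity) (fun ω => by rw [hY2init]) hL2
        (fun t => by rw [hny]; exact hle t _ (hA2 l t))
        (fun t ω => abs_le.2 ⟨by have := (hpb t ω).1; linarith, (hpb t ω).2⟩) hxi hpi hui hu2i
        (fun t => by rw [hny]; exact hx1 t _ (hA2 l t)) (fun t => by rw [hny]; exact hx3 t _ (hA2 l t))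
        (fun t => by rw [hny]; exact hpu t _ (hA2 l t)) hK (by simp_rw [hny]; exact hs)
      simp_rw [hny] at key
      simp_rw [e0]
      rw [← ENNReal.ofReal_tsum_of_nonneg (fun t => measureReal_nonneg) hs]
      apply ENNReal.ofReal_le_ofReal
      have hDp : 0 < max (θ + f) 0 + 1 / m * δ := by
        have : 0 < 1 / m * δ := by positivity
        have := le_max_right (θ + f) 0
        linarith
      rw [div_le_iff₀ hDp]
      have hS : 0 ≤ ∑' t, P.real (notYet Y2 l t) := tsum_nonneg fun t => measureReal_nonneg
      have : (θ + f + 1 / m * δ) * ∑' t, P.real (notYet Y2 l t) ≤ (max (θ + f) 0 + 1 / m * δ) * ∑' t, P.real (notYet Y2 l t) :=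
        mul_le_mul_of_nonneg_right (by linarith [le_max_left (θ + f) 0]) hS
      linarith
    · have : ∑' t, P (notYet Y2 l t) = ∞ := by
        by_contra hcon
        exact hs (ENNReal.summable_toReal hcon)
      rw [this]
      exact le_top
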